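/- Let n ≥ 3 be a natural number and let 0 < a ≤ b be real numbers. Then ∫_a^b ∫_a^b min(x^{−n}, y^{−n}) dx dy = (2/((n−1)(n−2)))·[b^{−n+1}((n−2)a − (n−1)b) + a^{−n+2}]. -/

import Mathlib

open intervalIntegral in
/-- The inner integral, obtained by splitting `[a, b]` at the point `y` where the minimum switches. -/
theorem integral_min_zpow_neg (n : ℕ) (hn : 2 ≤ n) {a b y : ℝ} (ha : 0 < a) (hay : a ≤ y)
    (hyb : y ≤ b) :
    ∫ x in a..b, min (x ^ (-(n : ℤ))) (y ^ (-(n : ℤ)))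
      = (y - a) * y ^ (-(n : ℤ))
        + (b ^ (-(n : ℤ) + 1) - y ^ (-(n : ℤ) + 1)) / (-(n : ℝ) + 1) := by
  have hy : 0 < y := ha.trans_le hay
  have anti : ∀ {u v : ℝ}, 0 < u → u ≤ v → v ^ (-(n : ℤ)) ≤ u ^ (-(n : ℤ)) := by
    intro u v hu huv
    simp only [zpow_neg, zpow_natCast]
    gcongr
  have e₁ : Set.EqOn (fun x : ℝ => min (x ^ (-(n : ℤ))) (y ^ (-(n : ℤ))))
      (fun _ => y ^ (-(n : ℤ))) (Set.uIcc a y) := by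
    intro x hx
    rw [Set.uIcc_of_le hay] at hx
    exact min_eq_right (anti (ha.trans_le hx.1) hx.2)
  have e₂ : Set.EqOn (fun x : ℝ => min (x ^ (-(n : ℤ))) (y ^ (-(n : ℤ))))
      (fun x => x ^ (-(n : ℤ))) (Set.uIcc y b) := by
    intro x hx
    rw [Set.uIcc_of_le hyb] at hx
    exact min_eq_left (anti hy hx.1)
  have h0 : (0 : ℝ) ∉ Set.uIcc y b := by
    rw [Set.uIcc_of_le hyb]
    exact fun h => hy.not_ge h.1
  have i₁ : IntervalIntegrable (fun x : ℝ => min (x ^ (-(n : ℤ))) (y ^ (-(n : ℤ))))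
      MeasureTheory.volume a y :=
    (continuousOn_const.congr e₁).intervalIntegrable
  have i₂ : IntervalIntegrable (fun x : ℝ => min (x ^ (-(n : ℤ))) (y ^ (-(n : ℤ))))
      MeasureTheory.volume y b :=
    (ContinuousOn.congr (fun x hx => (continuousAt_zpow₀ x _
      (Or.inl fun h => h0 (h ▸ hx))).continuousWithinAt) e₂).intervalIntegrable
  rw [← integral_add_adjacent_intervals i₁ i₂, integral_congr e₁, integral_congr e₂,
    integral_zpow (Or.inr ⟨by omega, h0⟩)]
  simp

open intervalIntegral in
theorem qIntegral_inv_pow (n : ℕ) (hn : 3 ≤ n) (a b : ℝ) (ha : 0 < a) (hab : a ≤ b) :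
    (∫ y in a..b, ∫ x in a..b, min (x ^ (-(n : ℤ))) (y ^ (-(n : ℤ))))
      = 2 / (((n : ℝ) - 1) * ((n : ℝ) - 2)) *
        (b ^ (-(n : ℤ) + 1) * (((n : ℝ) - 2) * a - ((n : ℝ) - 1) * b)
          + a ^ (-(n : ℤ) + 2)) := by
  have hb : 0 < b := ha.trans_le hab
  have hn' : (3 : ℝ) ≤ n := by exact_mod_cast hn
  have h₁ : (n : ℝ) - 1 ≠ 0 := by linarith
  have h₂ : (n : ℝ) - 2 ≠ 0 := by linarith
  have h0 : (0 : ℝ) ∉ Set.uIcc a b := by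
    rw [Set.uIcc_of_le hab]
    exact fun h => ha.not_ge h.1
  have key : Set.EqOn (fun y : ℝ => ∫ x in a..b, min (x ^ (-(n : ℤ))) (y ^ (-(n : ℤ))))
      (fun y => (1 - 1 / (-(n : ℝ) + 1)) * y ^ (-(n : ℤ) + 1) - a * y ^ (-(n : ℤ))
        + b ^ (-(n : ℤ) + 1) / (-(n : ℝ) + 1)) (Set.uIcc a b) := by
    intro y hy
    rw [Set.uIcc_of_le hab] at hy
    have hy0 : y ≠ 0 := (ha.trans_le hy.1).ne'
    simp only [integral_min_zpow_neg n (by omega) ha hy.1 hy.2]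
    rw [zpow_add_one₀ hy0]
    ring
  have I : ∀ m : ℤ, IntervalIntegrable (fun y : ℝ => y ^ m) MeasureTheory.volume a b :=
    fun m => intervalIntegrable_zpow (Or.inr h0)
  have e₂ : -(n : ℤ) + 1 + 1 = -(n : ℤ) + 2 := by ring
  have c₂ : ((-(n : ℤ) + 1 : ℤ) : ℝ) + 1 = -(n : ℝ) + 2 := by push_cast; ring
  have c₁ : ((-(n : ℤ) : ℤ) : ℝ) + 1 = -(n : ℝ) + 1 := by push_cast; ring
  have p : ∀ {t : ℝ}, 0 < t → t ^ (-(n : ℤ) + 2) = t ^ (-(n : ℤ) + 1) * t := by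
    intro t ht
    rw [← e₂, zpow_add_one₀ ht.ne']
  rw [integral_congr key,
    integral_add (((I _).const_mul _).sub ((I _).const_mul _)) intervalIntegrable_const,
    integral_sub ((I _).const_mul _) ((I _).const_mul _), integral_const_mul,
    integral_const_mul, integral_const, integral_zpow (Or.inr ⟨by omega, h0⟩),
    integral_zpow (Or.inr ⟨by omega, h0⟩), e₂, c₂, c₁, p ha, p hb, smul_eq_mul]
  rw [show -(n : ℝ) + 1 = -((n : ℝ) - 1) by ring, show -(n : ℝ) + 2 = -((n : ℝ) - 2) by ring]
  field_simp
  ring
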